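/- arXiv:2406.13231 — 4 statements merged into one kernel-verified Lean document; each statement's English description precedes it below -/
import Mathlib

section
/- In the graph G_{x,y}, the number of edges with one endpoint in A and the other in B' is exactly INT(x, y), and likewise the number of edges with one endpoint in B and the other in A' is exactly INT(x, y). Moreover, there are no edges between A and B, between A' and B', within any single part, or between A and A'∖(neighbors) other than those specified by the construction; in particular the cut (A ∪ A', B ∪ B') consists exactly of these 2·INT(x, y) edges, so the edge cut of the vertex set S = A ∪ A' has size exactly 2·INT(x, y). -/
open Finset

/-- The vertex set of `G_{x,y}`: part `0` is `A = {a_i}`, part `1` is `A' = {a'_j}`,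
part `2` is `B = {b_i}`, part `3` is `B' = {b'_j}`. -/
abbrev Vtx (ℓ : ℕ) := Fin 4 × Fin ℓ

/-- The defining relation of `G_{x,y}`: for each pair `(i, j)`, if `x_{ij} = y_{ij} = 1`
then the edges `(a_i, b'_j)` and `(b_i, a'_j)` are present, and otherwise the edges
`(a_i, a'_j)` and `(b_i, b'_j)` are present. -/
def gRel {ℓ : ℕ} (x y : Fin ℓ → Fin ℓ → Bool) (u v : Vtx ℓ) : Prop :=
  (u.1 = 0 ∧ v.1 = 3 ∧ (x u.2 v.2 = true ∧ y u.2 v.2 = true)) ∨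
  (u.1 = 2 ∧ v.1 = 1 ∧ (x u.2 v.2 = true ∧ y u.2 v.2 = true)) ∨
  (u.1 = 0 ∧ v.1 = 1 ∧ ¬(x u.2 v.2 = true ∧ y u.2 v.2 = true)) ∨
  (u.1 = 2 ∧ v.1 = 3 ∧ ¬(x u.2 v.2 = true ∧ y u.2 v.2 = true))

instance {ℓ : ℕ} (x y : Fin ℓ → Fin ℓ → Bool) (u v : Vtx ℓ) :
    Decidable (gRel x y u v) := by unfold gRel; infer_instance

/-- The simple undirected graph `G_{x,y}`. -/
def Gxy {ℓ : ℕ} (x y : Fin ℓ → Fin ℓ → Bool) : SimpleGraph (Vtx ℓ) :=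
  SimpleGraph.fromRel (gRel x y)

instance {ℓ : ℕ} (x y : Fin ℓ → Fin ℓ → Bool) : DecidableRel (Gxy x y).Adj :=
  fun u v => decidable_of_iff (u ≠ v ∧ (gRel x y u v ∨ gRel x y v u)) Iff.rfl

/-- `INT(x, y)`: the number of pairs `(i, j)` with `x_{ij} = y_{ij} = 1`. -/
def INT {ℓ : ℕ} (x y : Fin ℓ → Fin ℓ → Bool) : ℕ :=
  (univ.filter fun p : Fin ℓ × Fin ℓ => x p.1 p.2 = true ∧ y p.1 p.2 = true).card

/-- The size of the edge cut of a vertex set `S` in `G_{x,y}`: the number of edges with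
exactly one endpoint in `S`, counted as ordered pairs `(u, v)` with `u ∈ S`, `v ∉ S`,
`u ~ v` (each such edge corresponds to exactly one ordered pair). -/
def cutCard {ℓ : ℕ} (x y : Fin ℓ → Fin ℓ → Bool) (S : Finset (Vtx ℓ)) : ℕ :=
  (univ.filter fun p : Vtx ℓ × Vtx ℓ => p.1 ∈ S ∧ p.2 ∉ S ∧ (Gxy x y).Adj p.1 p.2).card

/-- In `G_{x,y}`, the number of edges between `A` and `B'` is
exactly `INT(x, y)` (counted as pairs `(i, j)` with `a_i ~ b'_j`), likewise the
number of edges between `B` and `A'` is exactly `INT(x, y)`, and the edge cut of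
the vertex set `S = A ∪ A'` has size exactly `2·INT(x, y)`. -/
theorem Gxy_cut_A_Aprime {ℓ : ℕ} (hℓ : 1 ≤ ℓ) (x y : Fin ℓ → Fin ℓ → Bool) :
    (univ.filter fun p : Fin ℓ × Fin ℓ =>
        (Gxy x y).Adj ((0 : Fin 4), p.1) ((3 : Fin 4), p.2)).card = INT x y ∧
    (univ.filter fun p : Fin ℓ × Fin ℓ =>
        (Gxy x y).Adj ((2 : Fin 4), p.1) ((1 : Fin 4), p.2)).card = INT x y ∧
    cutCard x y (univ.filter fun v : Vtx ℓ => v.1 = 0 ∨ v.1 = 1) = 2 * INT x y := by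
  have hA : ∀ u v : Vtx ℓ, (Gxy x y).Adj u v ↔ u ≠ v ∧ (gRel x y u v ∨ gRel x y v u) :=
    fun _ _ => Iff.rfl
  refine ⟨?_, ?_, ?_⟩
  · unfold INT
    congr 1
    ext p
    simp [hA, gRel]
  · unfold INT
    congr 1
    ext p
    simp [hA, gRel]
  · let f : Fin ℓ × Fin ℓ → Vtx ℓ × Vtx ℓ := fun p => ((0, p.1), (3, p.2))
    let g : Fin ℓ × Fin ℓ → Vtx ℓ × Vtx ℓ := fun p => ((1, p.2), (2, p.1))
    have hf : Function.Injective f := by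
      rintro ⟨a, b⟩ ⟨c, d⟩ h
      simpa [f] using h
    have hg : Function.Injective g := by
      rintro ⟨a, b⟩ ⟨c, d⟩ h
      simp only [g, Prod.mk.injEq, true_and] at h
      simp [h.1, h.2]
    unfold cutCard INT
    set I := univ.filter fun p : Fin ℓ × Fin ℓ => x p.1 p.2 = true ∧ y p.1 p.2 = true with hI
    have hd : Disjoint (I.image f) (I.image g) := by
      rw [Finset.disjoint_left]
      intro q h1 h2
      simp only [Finset.mem_image] at h1 h2
      obtain ⟨p, -, rfl⟩ := h1
      obtain ⟨r, -, h⟩ := h2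
      simp [f, g] at h
    rw [two_mul]
    have e : I.card + I.card = (I.image f ∪ I.image g).card := by
      rw [Finset.card_union_of_disjoint hd, Finset.card_image_of_injective I hf,
        Finset.card_image_of_injective I hg]
    rw [e]
    congr 1
    ext ⟨⟨a, i⟩, ⟨b, j⟩⟩
    fin_cases a <;> fin_cases b <;> simp [hA, gRel, f, g, hI]
end

section
/- If ℓ ≥ 3·INT(x, y), then for every nonempty proper subset S of the vertex set of G_{x,y}, the number of edges of G_{x,y} with exactly one endpoint in S is at least 2·INT(x, y). -/
open Finset

/-- The number of pairs separated by two non-matching Boolean labellings is at least `ℓ`. -/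
lemma pairs_card {ℓ : ℕ} (p q : Fin ℓ → Bool) (i0 j0 : Fin ℓ) (h : p i0 ≠ q j0) :
    ℓ ≤ (univ.filter fun t : Fin ℓ × Fin ℓ => p t.1 ≠ q t.2).card := by
  have key : ∀ f : Fin ℓ → Fin ℓ × Fin ℓ, Function.Injective f →
      (∀ i, p (f i).1 ≠ q (f i).2) →
      ℓ ≤ (univ.filter fun t : Fin ℓ × Fin ℓ => p t.1 ≠ q t.2).card := by
    intro f hf hp
    have := Finset.card_le_card_of_injOn (s := (univ : Finset (Fin ℓ)))
      (t := univ.filter fun t : Fin ℓ × Fin ℓ => p t.1 ≠ q t.2) f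
      (fun i _ => by simpa using hp i) hf.injOn
    simpa using this
  by_cases hc : ∀ i, ∃ j, p i ≠ q j
  · choose g hg using hc
    exact key (fun i => (i, g i)) (fun a b hab => (Prod.ext_iff.1 hab).1) hg
  · push Not at hc
    obtain ⟨i, hi⟩ := hc
    refine key (fun j => (i0, j)) (fun a b hab => (Prod.ext_iff.1 hab).2) ?_
    intro j
    show p i0 ≠ q j
    rw [← hi j, hi j0]
    exact h

/-- If `S` splits a copy of the (nearly complete) bipartite graph, the cut is large. -/
lemma split_bound {ℓ : ℕ} (x y : Fin ℓ → Fin ℓ → Bool) (h : 3 * INT x y ≤ ℓ)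
    (S : Finset (Vtx ℓ)) (c d : Fin 4) (hcd : (c = 0 ∧ d = 1) ∨ (c = 2 ∧ d = 3))
    (i0 j0 : Fin ℓ) (hne : ¬ ((c, i0) ∈ S ↔ (d, j0) ∈ S)) :
    2 * INT x y ≤ cutCard x y S := by
  classical
  have h1 := pairs_card (fun i => decide ((c, i) ∈ S)) (fun j => decide ((d, j) ∈ S)) i0 j0
    (by simpa using hne)
  set T := univ.filter fun t : Fin ℓ × Fin ℓ =>
    decide ((c, t.1) ∈ S) ≠ decide ((d, t.2) ∈ S) with hT
  set I := univ.filter fun p : Fin ℓ × Fin ℓ => x p.1 p.2 = true ∧ y p.1 p.2 = true with hI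
  have hIc : I.card = INT x y := rfl
  have h2 : T.card - I.card ≤ (T \ I).card := Finset.le_card_sdiff _ _
  have h3 : (T \ I).card ≤ cutCard x y S := by
    unfold cutCard
    refine Finset.card_le_card_of_injOn
      (fun t => if (c, t.1) ∈ S then ((c, t.1), (d, t.2)) else ((d, t.2), (c, t.1))) ?_ ?_
    · rintro ⟨i, j⟩ ht
      simp only [hT, hI, coe_sdiff, coe_filter, mem_univ, true_and, Set.mem_sdiff,
        Set.mem_ofPred_eq, ne_eq, decide_eq_decide] at ht
      obtain ⟨ht1, ht2⟩ := ht
      have hne : c ≠ d := by rcases hcd with ⟨rfl, rfl⟩ | ⟨rfl, rfl⟩ <;> decide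
      have hr : gRel x y (c, i) (d, j) := by
        unfold gRel
        rcases hcd with ⟨rfl, rfl⟩ | ⟨rfl, rfl⟩
        · exact Or.inr (Or.inr (Or.inl ⟨rfl, rfl, ht2⟩))
        · exact Or.inr (Or.inr (Or.inr ⟨rfl, rfl, ht2⟩))
      have ha : (Gxy x y).Adj (c, i) (d, j) :=
        ⟨fun e => hne (Prod.ext_iff.1 e).1, Or.inl hr⟩
      by_cases hc : (c, i) ∈ S
      · have hd : (d, j) ∉ S := by tauto
        simp [hc, hd, ha]
      · have hd : (d, j) ∈ S := by tauto
        simp [hc, hd, ha.symm]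
    · have hne : c ≠ d := by rcases hcd with ⟨rfl, rfl⟩ | ⟨rfl, rfl⟩ <;> decide
      rintro ⟨i, j⟩ _ ⟨i', j'⟩ _ e
      dsimp only at e
      split_ifs at e <;> simp_all
  omega

/-- If `ℓ ≥ 3·INT(x, y)`, then for every nonempty proper subset `S`
of the vertex set of `G_{x,y}`, the number of edges of `G_{x,y}` with exactly one
endpoint in `S` is at least `2·INT(x, y)`. -/
theorem Gxy_connectivity {ℓ : ℕ} (x y : Fin ℓ → Fin ℓ → Bool)
    (h : 3 * INT x y ≤ ℓ) (S : Finset (Vtx ℓ)) (hS : S.Nonempty)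
    (hS' : S ≠ Finset.univ) :
    2 * INT x y ≤ cutCard x y S := by
  classical
  by_cases hA : ∀ i j, ((0 : Fin 4), i) ∈ S ↔ ((1 : Fin 4), j) ∈ S
  swap
  · push Not at hA
    obtain ⟨i, j, hij⟩ := hA
    exact split_bound x y h S 0 1 (Or.inl ⟨rfl, rfl⟩) i j (by tauto)
  by_cases hB : ∀ i j, ((2 : Fin 4), i) ∈ S ↔ ((3 : Fin 4), j) ∈ S
  swap
  · push Not at hB
    obtain ⟨i, j, hij⟩ := hB
    exact split_bound x y h S 2 3 (Or.inr ⟨rfl, rfl⟩) i j (by tauto)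
  obtain ⟨⟨c0, z⟩, hz⟩ := hS
  have h0 : ∀ i, ((0 : Fin 4), i) ∈ S ↔ ((0 : Fin 4), z) ∈ S :=
    fun i => (hA i z).trans (hA z z).symm
  have h1 : ∀ i, ((1 : Fin 4), i) ∈ S ↔ ((0 : Fin 4), z) ∈ S := fun i => (hA z i).symm
  have h2 : ∀ i, ((2 : Fin 4), i) ∈ S ↔ ((2 : Fin 4), z) ∈ S :=
    fun i => (hB i z).trans (hB z z).symm
  have h3 : ∀ i, ((3 : Fin 4), i) ∈ S ↔ ((2 : Fin 4), z) ∈ S := fun i => (hB z i).symm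
  have hdiff : ((2 : Fin 4), z) ∈ S ↔ ((0 : Fin 4), z) ∉ S := by
    constructor
    · intro a b
      apply hS'
      ext ⟨c, i⟩
      have : (c, i) ∈ S := by
        fin_cases c
        · exact (h0 i).2 b
        · exact (h1 i).2 b
        · exact (h2 i).2 a
        · exact (h3 i).2 a
      simp [this]
    · intro b
      by_contra a
      fin_cases c0
      · exact b ((h0 z).1 hz)
      · exact b ((h1 z).1 hz)
      · exact a ((h2 z).1 hz)
      · exact a ((h3 z).1 hz)
  set I := univ.filter fun p : Fin ℓ × Fin ℓ => x p.1 p.2 = true ∧ y p.1 p.2 = true with hI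
  have hIc : I.card = INT x y := rfl
  have hcard : (I ×ˢ (univ : Finset Bool)).card = 2 * INT x y := by
    rw [Finset.card_product, hIc]; simp [mul_comm]
  rw [← hcard]
  unfold cutCard
  have adj1 : ∀ t ∈ I, (Gxy x y).Adj (0, t.1) (3, t.2) := by
    intro t ht
    refine ⟨fun e => absurd (Prod.ext_iff.1 e).1 (by simp), Or.inl (Or.inl ⟨rfl, rfl, ?_⟩)⟩
    simpa [hI] using ht
  have adj2 : ∀ t ∈ I, (Gxy x y).Adj (2, t.1) (1, t.2) := by
    intro t ht
    refine ⟨fun e => absurd (Prod.ext_iff.1 e).1 (by simp),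
      Or.inl (Or.inr (Or.inl ⟨rfl, rfl, ?_⟩))⟩
    simpa [hI] using ht
  by_cases hz0 : ((0 : Fin 4), z) ∈ S
  · refine Finset.card_le_card_of_injOn
      (fun t => if t.2 then ((0, t.1.1), (3, t.1.2)) else ((1, t.1.2), (2, t.1.1))) ?_ ?_
    · rintro ⟨t, b⟩ ht
      have ht' : t ∈ I := (Finset.mem_product.1 (Finset.mem_coe.1 ht)).1
      have := adj1 t ht'
      have := (adj2 t ht').symm
      cases b <;> simp_all
    · rintro ⟨⟨i, j⟩, b⟩ _ ⟨⟨i', j'⟩, b'⟩ _ e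
      cases b <;> cases b' <;> simp_all
  · refine Finset.card_le_card_of_injOn
      (fun t => if t.2 then ((3, t.1.2), (0, t.1.1)) else ((2, t.1.1), (1, t.1.2))) ?_ ?_
    · rintro ⟨t, b⟩ ht
      have ht' : t ∈ I := (Finset.mem_product.1 (Finset.mem_coe.1 ht)).1
      have := (adj1 t ht').symm
      have := adj2 t ht'
      cases b <;> simp_all
    · rintro ⟨⟨i, j⟩, b⟩ _ ⟨⟨i', j'⟩, b'⟩ _ e
      cases b <;> cases b' <;> simp_all
end

section
/- If ℓ ≥ 3·INT(x, y), then the minimum cut of G_{x,y} equals 2·INT(x, y); that is, the minimum, over all nonempty proper subsets S of the vertex set of G_{x,y}, of the number of edges with exactly one endpoint in S, is exactly 2·INT(x, y). -/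
open Finset

lemma mono_aux {ℓ : ℕ} (f g : Fin ℓ → Bool) (hne : ∃ i j, f i ≠ g j) :
    ℓ ≤ (univ.filter fun p : Fin ℓ × Fin ℓ => f p.1 ≠ g p.2).card := by
  have key : ∃ φ : Fin ℓ → Fin ℓ × Fin ℓ, Function.Injective φ ∧
      ∀ t, f (φ t).1 ≠ g (φ t).2 := by
    obtain ⟨i, j, hij⟩ := hne
    by_cases hc : ∀ t, f t ≠ g j
    · exact ⟨fun t => (t, j), fun s t hst => (Prod.ext_iff.1 hst).1, hc⟩
    · push Not at hc
      obtain ⟨s, hs⟩ := hc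
      have : ∀ t, ∃ r, f r ≠ g t := by
        intro t
        by_cases h1 : f i = g t
        · exact ⟨s, by rw [hs, ← h1]; exact hij.symm⟩
        · exact ⟨i, h1⟩
      choose r hr using this
      exact ⟨fun t => (r t, t), fun s t hst => (Prod.ext_iff.1 hst).2, hr⟩
  obtain ⟨φ, hφ, hm⟩ := key
  calc ℓ = (univ.image φ).card := by rw [card_image_of_injective _ hφ]; simp
    _ ≤ _ := by
      apply card_le_card
      intro p hp
      obtain ⟨t, -, rfl⟩ := mem_image.1 hp
      simpa using hm t

lemma side_aux {ℓ : ℕ} (x y : Fin ℓ → Fin ℓ → Bool) (h : 3 * INT x y ≤ ℓ)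
    (S : Finset (Vtx ℓ)) (p q : Fin 4) (hpq : p ≠ q)
    (hadj : ∀ i j, ¬(x i j = true ∧ y i j = true) → gRel x y (p, i) (q, j))
    (hne : ∃ i j, decide ((p, i) ∈ S) ≠ decide ((q, j) ∈ S)) :
    2 * INT x y ≤ cutCard x y S := by
  have h1 := mono_aux (fun i => decide ((p, i) ∈ S)) (fun j => decide ((q, j) ∈ S)) hne
  set D := (univ.filter fun r : Fin ℓ × Fin ℓ =>
    decide ((p, r.1) ∈ S) ≠ decide ((q, r.2) ∈ S)) with hD
  set I := (univ.filter fun p : Fin ℓ × Fin ℓ => x p.1 p.2 = true ∧ y p.1 p.2 = true) with hI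
  have hIc : I.card = INT x y := rfl
  have h2 : D.card - I.card ≤ (D \ I).card := le_card_sdiff I D
  have h3 : (D \ I).card ≤ cutCard x y S := by
    unfold cutCard
    apply card_le_card_of_injOn
      (fun r : Fin ℓ × Fin ℓ => if (p, r.1) ∈ S then ((p, r.1), (q, r.2)) else ((q, r.2), (p, r.1)))
    · intro r hr
      have hr' := mem_sdiff.1 (mem_coe.1 hr)
      have hd : decide ((p, r.1) ∈ S) ≠ decide ((q, r.2) ∈ S) := (mem_filter.1 hr'.1).2
      have hi : ¬(x r.1 r.2 = true ∧ y r.1 r.2 = true) := by simpa [hI] using hr'.2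
      have ha := hadj r.1 r.2 hi
      by_cases hp : (p, r.1) ∈ S
      · have hq : (q, r.2) ∉ S := by intro hq; simp [hp, hq] at hd
        simp [hp, hq, Gxy, SimpleGraph.fromRel_adj, ha, hpq]
      · have hq : (q, r.2) ∈ S := by by_contra hq; simp [hp, hq] at hd
        simp [hp, hq, Gxy, SimpleGraph.fromRel_adj, ha, hpq.symm]
    · rintro ⟨a, b⟩ - ⟨c, d⟩ - hrs
      dsimp only at hrs
      split_ifs at hrs <;> simp_all
  omega

/-- The two crossing edges attached to an intersecting pair. -/
def crossMap {ℓ : ℕ} (r : (Fin ℓ × Fin ℓ) × Bool) : Vtx ℓ × Vtx ℓ :=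
  if r.2 then ((0, r.1.1), (3, r.1.2)) else ((1, r.1.2), (2, r.1.1))

lemma crossMap_inj {ℓ : ℕ} : Function.Injective (crossMap (ℓ := ℓ)) := by
  rintro ⟨⟨a, b⟩, c⟩ ⟨⟨a', b'⟩, c'⟩ h
  cases c <;> cases c' <;> simp_all [crossMap]

lemma two_INT {ℓ : ℕ} (x y : Fin ℓ → Fin ℓ → Bool) :
    ((univ.filter fun p : Fin ℓ × Fin ℓ => x p.1 p.2 = true ∧ y p.1 p.2 = true) ×ˢ
      (univ : Finset Bool)).card = 2 * INT x y := by
  rw [card_product]; simp [INT, mul_comm]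

theorem Gxy_minCut {ℓ : ℕ} (hℓ : 1 ≤ ℓ) (x y : Fin ℓ → Fin ℓ → Bool)
    (h : 3 * INT x y ≤ ℓ) :
    sInf {c : ℕ | ∃ S : Finset (Vtx ℓ),
        S.Nonempty ∧ S ≠ Finset.univ ∧ cutCard x y S = c} = 2 * INT x y := by
  let o : Fin ℓ := ⟨0, hℓ⟩
  let S₀ : Finset (Vtx ℓ) := univ.filter fun u => u.1 = 0 ∨ u.1 = 1
  have hS₀ : S₀.Nonempty := ⟨(0, o), by simp [S₀]⟩
  have hS₀' : S₀ ≠ univ := by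
    intro he
    have : ((2, o) : Vtx ℓ) ∈ S₀ := he ▸ mem_univ _
    simp [S₀] at this
  have hmem : cutCard x y S₀ ∈ {c : ℕ | ∃ S : Finset (Vtx ℓ),
        S.Nonempty ∧ S ≠ Finset.univ ∧ cutCard x y S = c} := ⟨S₀, hS₀, hS₀', rfl⟩
  apply le_antisymm
  · refine (Nat.sInf_le hmem).trans ?_
    rw [← two_INT, ← card_image_of_injective _ crossMap_inj]
    apply card_le_card
    rintro ⟨⟨a, i⟩, ⟨b, j⟩⟩ hm
    obtain ⟨-, hu, hv, hadj⟩ := mem_filter.1 hm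
    have hu' : a = 0 ∨ a = 1 := by simpa [S₀] using hu
    have hv' : ¬ (b = 0 ∨ b = 1) := by simpa [S₀] using hv
    have hadj' := ((SimpleGraph.fromRel_adj _ _ _).1 hadj).2
    simp only [gRel] at hadj'
    rw [mem_image]
    rcases hu' with rfl | rfl
    · refine ⟨((i, j), true), ?_, ?_⟩
      · simp at hadj' hv' ⊢
        tauto
      · simp at hadj' hv' ⊢
        simp [crossMap]
        tauto
    · refine ⟨((j, i), false), ?_, ?_⟩
      · simp at hadj' hv' ⊢
        tauto
      · simp at hadj' hv' ⊢
        simp [crossMap]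
        tauto
  · apply le_csInf ⟨_, hmem⟩
    rintro c ⟨S, ⟨u, hu⟩, hSu, rfl⟩
    by_cases hA : ∃ i j, decide (((0 : Fin 4), i) ∈ S) ≠ decide (((1 : Fin 4), j) ∈ S)
    · exact side_aux x y h S 0 1 (by decide) (fun i j hij => by simp only [gRel]; tauto) hA
    by_cases hB : ∃ i j, decide (((2 : Fin 4), i) ∈ S) ≠ decide (((3 : Fin 4), j) ∈ S)
    · exact side_aux x y h S 2 3 (by decide) (fun i j hij => by simp only [gRel]; tauto) hB
    push Not at hA hB
    simp only [decide_eq_decide] at hA hB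
    have h0 : ∀ i, ((0 : Fin 4), i) ∈ S ↔ ((0 : Fin 4), o) ∈ S := fun i =>
      (hA i o).trans (hA o o).symm
    have h1 : ∀ i, ((1 : Fin 4), i) ∈ S ↔ ((0 : Fin 4), o) ∈ S := fun i => (hA o i).symm
    have h2 : ∀ i, ((2 : Fin 4), i) ∈ S ↔ ((2 : Fin 4), o) ∈ S := fun i =>
      (hB i o).trans (hB o o).symm
    have h3 : ∀ i, ((3 : Fin 4), i) ∈ S ↔ ((2 : Fin 4), o) ∈ S := fun i => (hB o i).symm
    rw [← two_INT]
    unfold cutCard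
    by_cases hP : ((0 : Fin 4), o) ∈ S
    · have hQ : ((2 : Fin 4), o) ∉ S := by
        intro hQ
        apply hSu
        ext ⟨a, i⟩
        have := h0 i; have := h1 i; have := h2 i; have := h3 i
        fin_cases a <;> simp_all
      apply card_le_card_of_injOn crossMap _ crossMap_inj.injOn
      rintro ⟨⟨i, j⟩, b⟩ hm
      have hxy : x i j = true ∧ y i j = true := by simpa using hm
      have := h0 i; have := h1 j; have := h2 i; have := h3 j
      cases b <;> simp_all [crossMap, Gxy, SimpleGraph.fromRel_adj, gRel]
    · have hQ : ((2 : Fin 4), o) ∈ S := by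
        by_contra hQ
        obtain ⟨a, i⟩ := u
        have := h0 i; have := h1 i; have := h2 i; have := h3 i
        fin_cases a <;> simp_all
      apply card_le_card_of_injOn (fun r => (crossMap r).swap) _
        (Prod.swap_injective.comp crossMap_inj).injOn
      rintro ⟨⟨i, j⟩, b⟩ hm
      have hxy : x i j = true ∧ y i j = true := by simpa using hm
      have := h0 i; have := h1 j; have := h2 i; have := h3 j
      cases b <;> simp_all [crossMap, Gxy, SimpleGraph.fromRel_adj, gRel]
end

section
/- For any two vertices a_i, a_{i'} ∈ A of the graph G_{x,y} (with i ≠ i'), the number of common neighbors of a_i and a_{i'} lying in A' is at least ℓ − INT(x, y). In particular, if ℓ ≥ 3·INT(x, y), then any two vertices of A have at least 2·INT(x, y) common neighbors in A'. -/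
open Finset

/-- For any two distinct vertices `a_i, a_{i'} ∈ A` of `G_{x,y}`,
the number of common neighbors of `a_i` and `a_{i'}` lying in `A'` is at least
`ℓ - INT(x, y)`; in particular, if `ℓ ≥ 3·INT(x, y)`, then any two vertices of `A`
have at least `2·INT(x, y)` common neighbors in `A'`. -/
theorem Gxy_common_neighbors {ℓ : ℕ} (x y : Fin ℓ → Fin ℓ → Bool)
    (i i' : Fin ℓ) (hii : i ≠ i') :
    ℓ - INT x y ≤ (univ.filter fun j : Fin ℓ =>
        (Gxy x y).Adj ((0 : Fin 4), i) ((1 : Fin 4), j) ∧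
        (Gxy x y).Adj ((0 : Fin 4), i') ((1 : Fin 4), j)).card ∧
    (3 * INT x y ≤ ℓ →
      2 * INT x y ≤ (univ.filter fun j : Fin ℓ =>
        (Gxy x y).Adj ((0 : Fin 4), i) ((1 : Fin 4), j) ∧
        (Gxy x y).Adj ((0 : Fin 4), i') ((1 : Fin 4), j)).card) := by
  have key : ℓ ≤ INT x y + (univ.filter fun j : Fin ℓ =>
        (Gxy x y).Adj ((0 : Fin 4), i) ((1 : Fin 4), j) ∧
        (Gxy x y).Adj ((0 : Fin 4), i') ((1 : Fin 4), j)).card := by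
    have adj : ∀ k j : Fin ℓ, ¬(x k j = true ∧ y k j = true) →
        (Gxy x y).Adj ((0 : Fin 4), k) ((1 : Fin 4), j) := by
      intro k j h
      refine ⟨?_, Or.inl (Or.inr (Or.inr (Or.inl ⟨rfl, rfl, h⟩)))⟩
      intro he
      exact absurd (congrArg Prod.fst he) (show ¬((0 : Fin 4) = 1) by decide)
    have hsub : (univ : Finset (Fin ℓ)) ⊆
        ((univ.filter fun p : Fin ℓ × Fin ℓ =>
          x p.1 p.2 = true ∧ y p.1 p.2 = true).image Prod.snd) ∪
        (univ.filter fun j : Fin ℓ =>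
          (Gxy x y).Adj ((0 : Fin 4), i) ((1 : Fin 4), j) ∧
          (Gxy x y).Adj ((0 : Fin 4), i') ((1 : Fin 4), j)) := by
      intro j _
      rw [mem_union]
      by_cases h : x i j = true ∧ y i j = true
      · exact Or.inl (mem_image.2 ⟨(i, j), mem_filter.2 ⟨mem_univ _, h⟩, rfl⟩)
      by_cases h' : x i' j = true ∧ y i' j = true
      · exact Or.inl (mem_image.2 ⟨(i', j), mem_filter.2 ⟨mem_univ _, h'⟩, rfl⟩)
      exact Or.inr (mem_filter.2 ⟨mem_univ _, adj i j h, adj i' j h'⟩)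
    have h1 := (card_le_card hsub).trans (card_union_le _ _)
    rw [card_univ, Fintype.card_fin] at h1
    exact h1.trans (Nat.add_le_add_right card_image_le _)
  constructor
  · omega
  · intro h
    omega
end
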